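/- arXiv:1703.03482 — 3 statements merged into one kernel-verified Lean document; each statement's English description precedes it below -/
import Mathlib

section
/- Let τ be a hereditary preradical in Mod B with τ(M) ≠ 0 for every nonzero M. If m ≤ l^{(τ,•)}(M), then τ_m(M) is the largest submodule N of M with l^{(τ,•)}(N) = m. -/
/-- A preradical on `Mod B`: a subfunctor of the identity functor. -/
structure Preradical (B : Type) [Ring B] where
  app : (M : ModuleCat.{0} B) → Submodule B M
  natural : ∀ {M N : ModuleCat.{0} B} (f : M →ₗ[B] N), (app M).map f ≤ app N

/-- A preradical `τ` is hereditary if `τ(N) = N ∩ τ(M)` for all submodules `N ⊆ M`. -/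
def Preradical.Hereditary {B : Type} [Ring B] (τ : Preradical B) : Prop :=
  ∀ (M : ModuleCat.{0} B) (N : Submodule B M),
    (τ.app (ModuleCat.of B N)).map N.subtype = N ⊓ τ.app M

/-- The ascending chain `τ_m(M)`: `τ_0(M) = 0` and
`τ_m(M)/τ_{m−1}(M) = τ(M/τ_{m−1}(M))`. -/
def chainApp {B : Type} [Ring B] (τ : Preradical B) (M : ModuleCat.{0} B) :
    ℕ → Submodule B M
  | 0 => ⊥
  | m + 1 => (τ.app (ModuleCat.of B (M ⧸ chainApp τ M m))).comap (chainApp τ M m).mkQ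

/-- A module `X` has `l^{(τ,•)}(X) = m` iff `m` is the least stage at which the chain
reaches `X`. -/
def chainLengthEq {B : Type} [Ring B] (τ : Preradical B) (X : ModuleCat.{0} B)
    (m : ℕ) : Prop :=
  chainApp τ X m = ⊤ ∧ ∀ k < m, chainApp τ X k ≠ ⊤

theorem Preradical.mem_iff {B : Type} [Ring B] (τ : Preradical B) (hτ : τ.Hereditary)
    {N M : ModuleCat.{0} B} (f : N →ₗ[B] M) (hf : Function.Injective f) (x : N) :
    x ∈ τ.app N ↔ f x ∈ τ.app M := by
  constructor
  · intro hx
    exact τ.natural f (Submodule.mem_map_of_mem hx)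
  · intro hx
    have h1 : f x ∈ LinearMap.range f ⊓ τ.app M := ⟨⟨x, rfl⟩, hx⟩
    rw [← hτ M (LinearMap.range f)] at h1
    obtain ⟨y, hy, hyx⟩ := h1
    let e := LinearEquiv.ofInjective f hf
    have h2 := τ.natural (M := ModuleCat.of B (LinearMap.range f)) (N := N)
      e.symm.toLinearMap (Submodule.mem_map_of_mem hy)
    have h3 : y = e x := Subtype.ext hyx
    rw [h3] at h2
    simpa using h2

theorem chainApp_comap {B : Type} [Ring B] (τ : Preradical B) (hτ : τ.Hereditary)
    {N M : ModuleCat.{0} B} (f : N →ₗ[B] M) (hf : Function.Injective f) (m : ℕ) :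
    chainApp τ N m = (chainApp τ M m).comap f := by
  induction m with
  | zero =>
    ext x
    simp only [chainApp, Submodule.mem_comap, Submodule.mem_bot]
    exact (map_eq_zero_iff f hf).symm
  | succ m ih =>
    ext x
    have hinj : Function.Injective
        ((chainApp τ N m).mapQ (chainApp τ M m) f ih.le) := by
      rw [← LinearMap.ker_eq_bot, Submodule.ker_mapQ, ← ih, Submodule.mkQ_map_self]
    exact Preradical.mem_iff τ hτ (N := ModuleCat.of B (N ⧸ chainApp τ N m))
      (M := ModuleCat.of B (M ⧸ chainApp τ M m)) _ hinj ((chainApp τ N m).mkQ x)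

theorem chainApp_le_succ {B : Type} [Ring B] (τ : Preradical B) (M : ModuleCat.{0} B) (m : ℕ) :
    chainApp τ M m ≤ chainApp τ M (m + 1) := by
  intro x hx
  change (chainApp τ M m).mkQ x ∈ τ.app (ModuleCat.of B (M ⧸ chainApp τ M m))
  have : (chainApp τ M m).mkQ x = 0 := by simpa using hx
  rw [this]
  exact Submodule.zero_mem _

/-- For a hereditary preradical `τ` over an Artin algebra with `τ(X) ≠ 0` for every
nonzero (finitely generated) `X`, and `m ≤ l^{(τ,•)}(M)` (i.e. the chain of `M` has not
reached `M` before stage `m`), `τ_m(M)` is the largest submodule `N` of `M` with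
`l^{(τ,•)}(N) = m`. -/
theorem chain_is_largest_of_length {B : Type} [Ring B] [IsArtinianRing B]
    (τ : Preradical B) (hτ : τ.Hereditary)
    (hτ0 : ∀ (X : ModuleCat.{0} B), Module.Finite B X → Nontrivial X → τ.app X ≠ ⊥)
    (M : ModuleCat.{0} B) (hM : Module.Finite B M) (m : ℕ)
    (hm : ∀ k < m, chainApp τ M k ≠ ⊤) :
    chainLengthEq τ (ModuleCat.of B (chainApp τ M m)) m ∧
    ∀ N : Submodule B M, chainLengthEq τ (ModuleCat.of B N) m →
      N ≤ chainApp τ M m := by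
  refine ⟨⟨?_, ?_⟩, ?_⟩
  · rw [chainApp_comap τ hτ (N := ModuleCat.of B (chainApp τ M m)) (M := M)
      (chainApp τ M m).subtype (Submodule.subtype_injective _) m]
    exact Submodule.comap_subtype_self _
  · intro k hk htop
    rw [chainApp_comap τ hτ (N := ModuleCat.of B (chainApp τ M m)) (M := M)
      (chainApp τ M m).subtype (Submodule.subtype_injective _) k] at htop
    have hle : chainApp τ M m ≤ chainApp τ M k := Submodule.comap_subtype_eq_top.1 htop
    have hmono : Monotone (chainApp τ M) := monotone_nat_of_le_succ (chainApp_le_succ τ M)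
    have hle2 : chainApp τ M (k + 1) ≤ chainApp τ M k := (hmono hk).trans hle
    have hnt : Nontrivial (M ⧸ chainApp τ M k) := Submodule.Quotient.nontrivial_iff.2 (hm k hk)
    refine hτ0 (ModuleCat.of B (M ⧸ chainApp τ M k))
      (inferInstanceAs (Module.Finite B (M ⧸ chainApp τ M k))) hnt ?_
    rw [eq_bot_iff]
    intro y hy
    obtain ⟨x, rfl⟩ := (chainApp τ M k).mkQ_surjective y
    have : x ∈ chainApp τ M k := hle2 hy
    exact (Submodule.Quotient.mk_eq_zero _).2 this
  · intro N hN
    have h := hN.1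
    rw [chainApp_comap τ hτ (N := ModuleCat.of B N) (M := M)
      N.subtype (Submodule.subtype_injective _) m] at h
    exact Submodule.comap_subtype_eq_top.1 h
end

section
/- Let A be an Artin algebra and M a rigid A-module of Loewy length m (i.e., rad^i M = soc^{m−i} M for all 0 ≤ i ≤ m). Then every homomorphism f: P → M, where P is a projective module over A/rad^j(A) (viewed as an A-module) with j < m, factors through the projective cover ε: P₀(M) → M of M as an (A/rad^m A)-module. Consequently ε is a right minimal Add(G)-approximation of M, where G = ⊕_{j=1}^{L} A/rad^j A (L the Loewy length of A). -/
section

variable (A : Type) [Ring A]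

/-- The radical of a module: the intersection of all maximal submodules. -/
def radSub (M : Type) [AddCommGroup M] [Module A M] : Submodule A M :=
  sInf {p : Submodule A M | IsCoatom p}

/-- The radical series `rad^k M`, as submodules of `M`: `rad^0 M = M` and
`rad^{k+1} M = rad(rad^k M)`. -/
def radSeries (M : Type) [AddCommGroup M] [Module A M] : ℕ → Submodule A M
  | 0 => ⊤
  | k + 1 => (radSub A (radSeries M k)).map (radSeries M k).subtype

/-- The socle of a module: the sum of all simple (atomic) submodules. -/
def socleSub (M : Type) [AddCommGroup M] [Module A M] : Submodule A M :=
  sSup {p : Submodule A M | IsAtom p}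

/-- The socle series `soc^k M`: `soc^0 M = 0` and `soc^{k+1} M/soc^k M = soc(M/soc^k M)`. -/
def socSeries (M : Type) [AddCommGroup M] [Module A M] : ℕ → Submodule A M
  | 0 => ⊥
  | k + 1 => (socleSub A (M ⧸ socSeries M k)).comap (socSeries M k).mkQ

/-- `P` is (the restriction to `A` of) a projective module over `A/rad^j A`:
`rad^j P = 0`, and `P` has the lifting property against all surjections of `A`-modules
annihilated in the same way (i.e. all surjections in `Mod (A/rad^j A)`). -/
def AnnRadProj (j : ℕ) (P : Type) [AddCommGroup P] [Module A P] : Prop :=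
  radSeries A P j = ⊥ ∧
  ∀ (X Y : Type) [AddCommGroup X] [Module A X] [AddCommGroup Y] [Module A Y],
    radSeries A X j = ⊥ → radSeries A Y j = ⊥ →
    ∀ (q : X →ₗ[A] Y), Function.Surjective q →
    ∀ (f : P →ₗ[A] Y), ∃ g : P →ₗ[A] X, q.comp g = f

/-- `X ∈ Add G` for `G = ⊕_{j=1}^{L} A/rad^j A`: `X` is a direct summand of a finite
direct sum of modules `A/rad^j A` with `1 ≤ j ≤ L`. -/
def InAddG (L : ℕ) (X : Type) [AddCommGroup X] [Module A X] : Prop :=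
  ∃ (κ : Type) (_ : Fintype κ) (jdx : κ → ℕ),
    (∀ i, 1 ≤ jdx i ∧ jdx i ≤ L) ∧
    ∃ (s : X →ₗ[A] ((i : κ) → A ⧸ radSeries A A (jdx i)))
      (r : ((i : κ) → A ⧸ radSeries A A (jdx i)) →ₗ[A] X),
      r.comp s = LinearMap.id

theorem aux_semisimple [IsArtinianRing A] (M : Type) [AddCommGroup M] [Module A M]
    (h : Ring.jacobson A • (⊤ : Submodule A M) = ⊥) : IsSemisimpleModule A M := by
  have h' : Module.IsTorsionBySet A M (Ring.jacobson A) := by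
    intro x a
    have : (a : A) • x ∈ Ring.jacobson A • (⊤ : Submodule A M) :=
      Submodule.smul_mem_smul a.2 trivial
    rw [h] at this
    simpa using this
  let _ := h'.module
  exact (h'.semilinearMap.isSemisimpleModule_iff_of_bijective Function.bijective_id).2
      inferInstance

theorem aux_radSub [IsArtinianRing A] (M : Type) [AddCommGroup M] [Module A M] :
    radSub A M = Ring.jacobson A • (⊤ : Submodule A M) := by
  change Module.jacobson A M = _
  refine le_antisymm ?_ (Ring.jacobson_smul_top_le A M)
  apply Module.jacobson_le_of_eq_bot
  have : IsSemisimpleModule A (M ⧸ (Ring.jacobson A • (⊤ : Submodule A M))) := by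
    apply aux_semisimple
    rw [← Submodule.range_mkQ, ← Submodule.map_top, ← Submodule.map_smul'',
      Submodule.mkQ_map_self]
  exact IsSemisimpleModule.jacobson_eq_bot A _

theorem aux_rad_succ [IsArtinianRing A] (M : Type) [AddCommGroup M] [Module A M] (k : ℕ) :
    radSeries A M (k + 1) = Ring.jacobson A • radSeries A M k := by
  change (radSub A (radSeries A M k)).map (radSeries A M k).subtype = _
  rw [aux_radSub, Submodule.map_smul'', Submodule.map_top, Submodule.range_subtype]

theorem aux_rad_map_le [IsArtinianRing A] {M N : Type} [AddCommGroup M] [Module A M]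
    [AddCommGroup N] [Module A N] (f : M →ₗ[A] N) (k : ℕ) :
    (radSeries A M k).map f ≤ radSeries A N k := by
  induction k with
  | zero => exact le_top
  | succ k ih =>
    rw [aux_rad_succ, aux_rad_succ, Submodule.map_smul'']
    exact smul_mono_right _ ih

theorem aux_rad_map [IsArtinianRing A] {M N : Type} [AddCommGroup M] [Module A M]
    [AddCommGroup N] [Module A N] (f : M →ₗ[A] N) (hf : Function.Surjective f) (k : ℕ) :
    (radSeries A M k).map f = radSeries A N k := by
  induction k with
  | zero => exact (Submodule.map_top f).trans (LinearMap.range_eq_top.2 hf)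
  | succ k ih => rw [aux_rad_succ, aux_rad_succ, Submodule.map_smul'', ih]

theorem aux_rad_add [IsArtinianRing A] (M : Type) [AddCommGroup M] [Module A M] (a b : ℕ) :
    (radSeries A (radSeries A M a) b).map (radSeries A M a).subtype = radSeries A M (a + b) := by
  induction b with
  | zero => exact (Submodule.map_top _).trans (Submodule.range_subtype _)
  | succ b ih => rw [← add_assoc, aux_rad_succ, aux_rad_succ, Submodule.map_smul'', ih]

theorem aux_rad_sub_bot [IsArtinianRing A] (M : Type) [AddCommGroup M] [Module A M] (a b : ℕ)
    (h : radSeries A M (a + b) = ⊥) : radSeries A (radSeries A M a) b = ⊥ := by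
  rw [← aux_rad_add] at h
  exact Submodule.map_injective_of_injective (Submodule.injective_subtype _)
    (h.trans (Submodule.map_bot _).symm)

theorem aux_rad_anti [IsArtinianRing A] (M : Type) [AddCommGroup M] [Module A M] (a b : ℕ)
    (hab : a ≤ b) (h : radSeries A M a = ⊥) : radSeries A M b = ⊥ := by
  obtain ⟨c, rfl⟩ := Nat.exists_eq_add_of_le hab
  rw [← aux_rad_add, eq_bot_iff, ← h]
  exact Submodule.map_subtype_le _ _

theorem aux_rad_bot_of_ring [IsArtinianRing A] (M : Type) [AddCommGroup M] [Module A M] (k : ℕ)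
    (h : radSeries A A k = ⊥) : radSeries A M k = ⊥ := by
  have key : ∀ k, radSeries A M k = radSeries A A k • (⊤ : Submodule A M) := by
    intro k
    induction k with
    | zero => exact (Submodule.top_smul _).symm
    | succ k ih =>
      rw [aux_rad_succ, ih, aux_rad_succ, ← Submodule.smul_assoc]
  rw [key, h, Submodule.bot_smul]

theorem aux_soc_of_semisimple [IsArtinianRing A] (M : Type) [AddCommGroup M] [Module A M]
    (N : Submodule A M) (h : Ring.jacobson A • N = ⊥) : N ≤ socleSub A M := by
  have : IsSemisimpleModule A N := by
    apply aux_semisimple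
    apply Submodule.map_injective_of_injective (Submodule.injective_subtype N)
    rw [Submodule.map_bot, Submodule.map_smul'', Submodule.map_top, Submodule.range_subtype, h]
  have h2 := IsSemisimpleModule.sSup_simples_eq_top A N
  have h3 : N = (⊤ : Submodule A N).map N.subtype := by
    rw [Submodule.map_top, Submodule.range_subtype]
  rw [h3, Submodule.map_le_iff_le_comap, ← h2]
  refine sSup_le fun S hS => ?_
  rw [← Submodule.map_le_iff_le_comap]
  refine le_sSup ?_
  have hS' : IsSimpleModule A S := hS
  change IsAtom _
  rw [← isSimpleModule_iff_isAtom]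
  exact IsSimpleModule.congr (Submodule.equivMapOfInjective _ N.injective_subtype S).symm

theorem aux_soc_succ [IsArtinianRing A] (M : Type) [AddCommGroup M] [Module A M]
    (N : Submodule A M) (k : ℕ) (h : Ring.jacobson A • N ≤ socSeries A M k) :
    N ≤ socSeries A M (k + 1) := by
  change N ≤ (socleSub A (M ⧸ socSeries A M k)).comap (socSeries A M k).mkQ
  rw [← Submodule.map_le_iff_le_comap]
  apply aux_soc_of_semisimple
  rw [← Submodule.map_smul'', eq_bot_iff, Submodule.map_le_iff_le_comap, Submodule.comap_bot,
    Submodule.ker_mkQ]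
  exact h

theorem aux_range_le_soc [IsArtinianRing A] {P M : Type} [AddCommGroup P] [Module A P]
    [AddCommGroup M] [Module A M] (f : P →ₗ[A] M) (j : ℕ) (h : radSeries A P j = ⊥) :
    LinearMap.range f ≤ socSeries A M j := by
  have key : ∀ k a, a + k = j → (radSeries A P a).map f ≤ socSeries A M k := by
    intro k
    induction k with
    | zero =>
      intro a ha
      have : a = j := ha
      rw [this, h, Submodule.map_bot]
      exact bot_le
    | succ k ih =>
      intro a ha
      apply aux_soc_succ
      rw [← Submodule.map_smul'', ← aux_rad_succ]
      exact ih (a + 1) (by omega)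
  have := key j 0 (by omega)
  rwa [show radSeries A P 0 = ⊤ from rfl, Submodule.map_top] at this

theorem aux_quot_rad [IsArtinianRing A] (j : ℕ) :
    radSeries A (A ⧸ radSeries A A j) j = ⊥ := by
  rw [← aux_rad_map A (radSeries A A j).mkQ (Submodule.mkQ_surjective _), Submodule.mkQ_map_self]

theorem aux_quot_hom [IsArtinianRing A] (X : Type) [AddCommGroup X] [Module A X] (j : ℕ)
    (hX : radSeries A X j = ⊥) (x : X) :
    ∃ g : (A ⧸ radSeries A A j) →ₗ[A] X, g (Submodule.Quotient.mk 1) = x := by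
  refine ⟨(radSeries A A j).liftQ (LinearMap.toSpanSingleton A X x) ?_, ?_⟩
  · rw [← Submodule.comap_bot, ← Submodule.map_le_iff_le_comap, ← hX]
    exact aux_rad_map_le A _ j
  · simp

theorem aux_quot_ext (X : Type) [AddCommGroup X] [Module A X] (j : ℕ)
    (f g : (A ⧸ radSeries A A j) →ₗ[A] X)
    (h : f (Submodule.Quotient.mk 1) = g (Submodule.Quotient.mk 1)) : f = g := by
  apply Submodule.linearMap_qext
  apply LinearMap.ext_ring
  exact h

theorem aux_quot_proj [IsArtinianRing A] (j : ℕ) : AnnRadProj A j (A ⧸ radSeries A A j) := by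
  refine ⟨aux_quot_rad A j, ?_⟩
  intro X Y _ _ _ _ hX hY q hq f
  obtain ⟨x, hx⟩ := hq (f (Submodule.Quotient.mk 1))
  obtain ⟨g, hg⟩ := aux_quot_hom A X j hX x
  refine ⟨g, aux_quot_ext A Y j _ _ ?_⟩
  rw [LinearMap.comp_apply, hg, hx]

theorem aux_pi_rad [IsArtinianRing A] (n j : ℕ) :
    radSeries A (Fin n → A ⧸ radSeries A A j) j = ⊥ := by
  rw [eq_bot_iff]
  intro x hx
  rw [Submodule.mem_bot]
  funext i
  have := aux_rad_map_le A (LinearMap.proj (R := A) (φ := fun _ : Fin n => A ⧸ radSeries A A j) i) j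
    (Submodule.mem_map_of_mem hx)
  rw [aux_quot_rad] at this
  simpa using this

/-- Let `A` be an Artin algebra of Loewy length `L` and `M` a rigid `A`-module of Loewy
length `m` (`rad^i M = soc^{m−i} M` for `0 ≤ i ≤ m`). Let `ε : P₀ → M` be the
projective cover of `M` in `Mod (A/rad^m A)` (so `P₀` is projective over `A/rad^m A`,
`ε` is surjective, and `ker ε` is superfluous in `P₀`). Then every homomorphism
`f : P → M` with `P` projective over `A/rad^j A`, `j < m`, factors through `ε`;
consequently `ε` is a right minimal `Add G`-approximation of `M`, where
`G = ⊕_{j=1}^{L} A/rad^j A`. -/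
theorem rigid_projective_cover_is_addG_approximation [IsArtinianRing A]
    (L : ℕ) (hLA : radSeries A A L = ⊥) (hLA' : ∀ k < L, radSeries A A k ≠ ⊥)
    (M : Type) [AddCommGroup M] [Module A M] [Module.Finite A M]
    (m : ℕ)
    (hrig : ∀ i ≤ m, radSeries A M i = socSeries A M (m - i))
    (hLL : ∀ k < m, radSeries A M k ≠ ⊥)
    (P₀ : Type) [AddCommGroup P₀] [Module A P₀]
    (hP₀ : AnnRadProj A m P₀)
    (ε : P₀ →ₗ[A] M) (hε : Function.Surjective ε)
    (hsmall : ∀ N : Submodule A P₀, N ⊔ LinearMap.ker ε = ⊤ → N = ⊤) :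
    (∀ j < m, ∀ (P : Type) [AddCommGroup P] [Module A P], AnnRadProj A j P →
      ∀ f : P →ₗ[A] M, ∃ t : P →ₗ[A] P₀, ε.comp t = f) ∧
    InAddG A L P₀ ∧
    (∀ (X : Type) [AddCommGroup X] [Module A X], InAddG A L X →
      ∀ h : X →ₗ[A] M, ∃ t : X →ₗ[A] P₀, ε.comp t = h) ∧
    (∀ g : P₀ →ₗ[A] P₀, ε.comp g = ε → Function.Bijective g) := by
  have hM : radSeries A M m = ⊥ := by
    have := hrig m le_rfl
    rw [Nat.sub_self] at this
    exact this
  have hmL : m ≤ L := by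
    by_contra hlt
    exact hLL L (not_le.1 hlt) (aux_rad_bot_of_ring A M L hLA)
  have part1 : ∀ j < m, ∀ (P : Type) [AddCommGroup P] [Module A P], AnnRadProj A j P →
      ∀ f : P →ₗ[A] M, ∃ t : P →ₗ[A] P₀, ε.comp t = f := by
    intro j hj P _ _ hP f
    have hr : LinearMap.range f ≤ radSeries A M (m - j) := by
      rw [hrig (m - j) (Nat.sub_le _ _), Nat.sub_sub_self hj.le]
      exact aux_range_le_soc A f j hP.1
    have hmap := aux_rad_map A ε hε (m - j)
    have hmj : m - j + j = m := Nat.sub_add_cancel hj.le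
    let q : radSeries A P₀ (m - j) →ₗ[A] radSeries A M (m - j) :=
      (ε.comp (radSeries A P₀ (m - j)).subtype).codRestrict _ (fun x => by
        rw [← hmap]
        exact Submodule.mem_map_of_mem x.2)
    have hq : Function.Surjective q := by
      rintro ⟨y, hy⟩
      have hy' := hy
      rw [← hmap] at hy'
      obtain ⟨x, hx, rfl⟩ := hy'
      exact ⟨⟨x, hx⟩, rfl⟩
    obtain ⟨g, hg⟩ := hP.2 _ _ (aux_rad_sub_bot A P₀ (m - j) j (by rw [hmj]; exact hP₀.1))
      (aux_rad_sub_bot A M (m - j) j (by rw [hmj]; exact hM)) q hq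
      (f.codRestrict _ (fun x => hr (LinearMap.mem_range_self f x)))
    refine ⟨(radSeries A P₀ (m - j)).subtype.comp g, ?_⟩
    ext x
    have := congrArg Subtype.val (LinearMap.congr_fun hg x)
    exact this
  have hfin : Module.Finite A P₀ := by
    obtain ⟨n, b, hb⟩ := Module.Finite.exists_fin (R := A) (M := M)
    choose c hc using fun i => hε (b i)
    refine ⟨?_⟩
    have : Submodule.span A (Set.range c) = ⊤ := by
      apply hsmall
      rw [← Submodule.comap_map_eq, Submodule.map_span, ← Set.range_comp,
        show (⇑ε ∘ c) = b from funext hc, hb, Submodule.comap_top]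
    rw [← this]
    exact Submodule.fg_span (Set.finite_range c)
  refine ⟨part1, ?_, ?_, ?_⟩
  · rcases Nat.eq_zero_or_pos m with h0 | hpos
    · subst h0
      have h1 : (⊤ : Submodule A P₀) = ⊥ := hP₀.1
      refine ⟨Empty, inferInstance, fun _ => 1, fun i => i.elim, 0, 0, ?_⟩
      ext x
      have : x ∈ (⊥ : Submodule A P₀) := h1 ▸ Submodule.mem_top
      rw [Submodule.mem_bot] at this
      simp [this]
    · obtain ⟨n, b, hb⟩ := Module.Finite.exists_fin (R := A) (M := P₀)
      choose g hg using fun i => aux_quot_hom A P₀ m hP₀.1 (b i)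
      let r : (Fin n → A ⧸ radSeries A A m) →ₗ[A] P₀ :=
        ∑ i, (g i).comp (LinearMap.proj i)
      have hr : Function.Surjective r := by
        rw [← LinearMap.range_eq_top, eq_top_iff, ← hb, Submodule.span_le]
        rintro _ ⟨i, rfl⟩
        refine ⟨Pi.single i (Submodule.Quotient.mk 1), ?_⟩
        simp only [r, LinearMap.sum_apply, LinearMap.comp_apply, LinearMap.proj_apply]
        rw [Finset.sum_eq_single i]
        · rw [Pi.single_eq_same, hg]
        · intro k _ hk
          rw [Pi.single_eq_of_ne hk, map_zero]
        · simp
      obtain ⟨s, hs⟩ := hP₀.2 _ _ (aux_pi_rad A n m) hP₀.1 r hr LinearMap.id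
      exact ⟨Fin n, inferInstance, fun _ => m, fun _ => ⟨hpos, hmL⟩, s, r, hs⟩
  · rintro X _ _ ⟨κ, _, jdx, hj, s, r, hrs⟩ h
    classical
    have hl : ∀ i, ∃ t : (A ⧸ radSeries A A (jdx i)) →ₗ[A] P₀,
        ε.comp t = (h.comp r).comp
          (LinearMap.single A (fun i => A ⧸ radSeries A A (jdx i)) i) := by
      intro i
      rcases lt_or_ge (jdx i) m with hlt | hge
      · exact part1 _ hlt _ (aux_quot_proj A _) _
      · exact (aux_quot_proj A (jdx i)).2 _ _ (aux_rad_anti A P₀ m _ hge hP₀.1)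
          (aux_rad_anti A M m _ hge hM) ε hε _
    choose t ht using hl
    let T : ((i : κ) → A ⧸ radSeries A A (jdx i)) →ₗ[A] P₀ :=
      ∑ i, (t i).comp (LinearMap.proj i)
    have hT : ε.comp T = h.comp r := by
      apply LinearMap.pi_ext'
      intro i
      rw [← ht i]
      ext x
      simp only [T, LinearMap.comp_apply, LinearMap.sum_apply, LinearMap.proj_apply]
      rw [Finset.sum_eq_single i]
      · simp
      · intro k _ hk
        simp [Pi.single_eq_of_ne hk]
      · simp
    refine ⟨T.comp s, ?_⟩
    rw [← LinearMap.comp_assoc, hT, LinearMap.comp_assoc, hrs, LinearMap.comp_id]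
  · intro g hg
    have hsurj : Function.Surjective g := by
      rw [← LinearMap.range_eq_top]
      apply hsmall
      rw [eq_top_iff]
      intro x _
      rw [show x = g x + (x - g x) by abel]
      refine Submodule.add_mem_sup (LinearMap.mem_range_self g x) ?_
      rw [LinearMap.mem_ker, map_sub, sub_eq_zero]
      exact (LinearMap.congr_fun hg x).symm
    exact IsNoetherian.bijective_of_surjective_endomorphism g hsurj

end
end

section
/- Let A be an Artin algebra with Loewy length L and G = ⊕_{i,j} P_i/rad^j(P_i) (over all projective indecomposables P_i and 1 ≤ j ≤ LL(P_i)). For M ∈ Mod A, the R_A-submodule Hom_A(G, soc^j M) of Hom_A(G, M) equals the trace of ⊕_{(k,l): l ≤ j} P_{k,l} in Hom_A(G, M), where P_{k,l} = Hom_A(G, P_k/rad^l P_k). -/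
section

variable (A : Type) [Ring A]

/-- The module `G = ⊕_{i=1}^n ⊕_{j=1}^{l_i} P_i/rad^j(P_i)`, realised as the (finite)
product over pairs `(i, j)` with `1 ≤ j ≤ l_i`. -/
abbrev Gmod (n : ℕ) (P : Fin n → Type) [∀ i, AddCommGroup (P i)]
    [∀ i, Module A (P i)] (l : Fin n → ℕ) : Type :=
  (p : Σ i : Fin n, Fin (l i)) → P p.1 ⧸ radSeries A (P p.1) (p.2.val + 1)

/-- For a submodule `N ⊆ M`, the subgroup `Hom_A(G, N)` of `Hom_A(G, M)`: the maps
whose image lies in `N`. It is an `R_A`-submodule for `R_A = End_A(G)^op` acting by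
precomposition. -/
def homInto {G M : Type} [AddCommGroup G] [Module A G] [AddCommGroup M] [Module A M]
    (N : Submodule A M) : AddSubgroup (G →ₗ[A] M) where
  carrier := {φ | ∀ x, φ x ∈ N}
  add_mem' := fun h1 h2 x => by simpa using N.add_mem (h1 x) (h2 x)
  zero_mem' := fun x => by simpa using N.zero_mem
  neg_mem' := fun h x => by simpa using N.neg_mem (h x)

theorem aux_range_le {X Y : Type} [AddCommGroup X] [Module A X] [AddCommGroup Y] [Module A Y]
    [IsSemisimpleModule A X] (f : X →ₗ[A] Y) : LinearMap.range f ≤ socleSub A Y := by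
  have hN : IsSemisimpleModule A (LinearMap.range f) := .range f
  have h1 := IsSemisimpleModule.sSup_simples_eq_top A (LinearMap.range f)
  have h2 : (⊤ : Submodule A (LinearMap.range f)) ≤
      (socleSub A Y).comap (LinearMap.range f).subtype := by
    rw [← h1]
    refine sSup_le fun m hm => ?_
    rw [← Submodule.map_le_iff_le_comap]
    have hm' : IsSimpleModule A m := hm
    have : IsSimpleModule A (m.map (LinearMap.range f).subtype) :=
      IsSimpleModule.congr (Submodule.equivSubtypeMap _ m).symm
    exact le_sSup (isSimpleModule_iff_isAtom.mp this)
  intro y hy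
  exact h2 (x := ⟨y, hy⟩) trivial

theorem aux_jac_soc (Y : Type) [AddCommGroup Y] [Module A Y] :
    Module.jacobson A (socleSub A Y) = ⊥ := by
  have : IsSemisimpleModule A (socleSub A Y) := by
    unfold socleSub
    rw [sSup_eq_iSup]
    refine isSemisimpleModule_biSup_of_isSemisimpleModule_submodule ?_
    intro m hm
    have : IsSimpleModule A m := isSimpleModule_iff_isAtom.mpr hm
    infer_instance
  exact IsSemisimpleModule.jacobson_eq_bot A _

theorem aux_down {X M : Type} [AddCommGroup X] [Module A X] [AddCommGroup M] [Module A M]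
    (f : X →ₗ[A] M) (k i : ℕ) (h : ∀ x ∈ radSeries A X i, f x ∈ socSeries A M (k + 1)) :
    ∀ x ∈ radSeries A X (i + 1), f x ∈ socSeries A M k := by
  rintro _ ⟨⟨x, hx⟩, hj, rfl⟩
  let g : radSeries A X i →ₗ[A] socleSub A (M ⧸ socSeries A M k) :=
    LinearMap.codRestrict _ ((socSeries A M k).mkQ ∘ₗ f ∘ₗ (radSeries A X i).subtype)
      (fun y => h y.1 y.2)
  have h1 := Module.le_comap_jacobson g hj
  rw [aux_jac_soc] at h1
  have h2 : (g ⟨x, hx⟩ : M ⧸ socSeries A M k) = 0 := by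
    have : g ⟨x, hx⟩ = 0 := by simpa using h1
    rw [this]; rfl
  exact (Submodule.Quotient.mk_eq_zero _).mp h2

theorem aux_up [IsArtinianRing A] {X M : Type} [AddCommGroup X] [Module A X] [Module.Finite A X]
    [AddCommGroup M] [Module A M]
    (f : X →ₗ[A] M) (k i : ℕ) (h : ∀ x ∈ radSeries A X (i + 1), f x ∈ socSeries A M k) :
    ∀ x ∈ radSeries A X i, f x ∈ socSeries A M (k + 1) := by
  intro x hx
  let N := radSeries A X i
  let g : N →ₗ[A] M ⧸ socSeries A M k := (socSeries A M k).mkQ ∘ₗ f ∘ₗ N.subtype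
  have hg : Module.jacobson A N ≤ LinearMap.ker g := by
    intro y hy
    exact (Submodule.Quotient.mk_eq_zero _).mpr (h y.1 ⟨y, hy, rfl⟩)
  have : IsSemisimpleModule A (N ⧸ Module.jacobson A N) :=
    (IsArtinian.isSemisimpleModule_iff_jacobson A _).mpr (Module.jacobson_quotient_jacobson A N)
  exact aux_range_le A ((Module.jacobson A N).liftQ g hg)
    ⟨(Module.jacobson A N).mkQ ⟨x, hx⟩, rfl⟩

theorem aux_soc_mono (M : Type) [AddCommGroup M] [Module A M] : Monotone (socSeries A M) := by
  refine monotone_nat_of_le_succ fun k x hx => ?_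
  change (socSeries A M k).mkQ x ∈ socleSub A (M ⧸ socSeries A M k)
  have : (socSeries A M k).mkQ x = 0 := (Submodule.Quotient.mk_eq_zero _).mpr hx
  rw [this]
  exact zero_mem _

theorem aux_rad_anti_s19 (X : Type) [AddCommGroup X] [Module A X] : Antitone (radSeries A X) :=
  antitone_nat_of_succ_le fun _ => Submodule.map_subtype_le _ _

theorem aux_into_soc [IsArtinianRing A] {X M : Type} [AddCommGroup X] [Module A X]
    [Module.Finite A X] [AddCommGroup M] [Module A M]
    (l : ℕ) (f : (X ⧸ radSeries A X l) →ₗ[A] M) (y) : f y ∈ socSeries A M l := by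
  obtain ⟨x, rfl⟩ := Submodule.mkQ_surjective _ y
  have key : ∀ k i, i + k = l → ∀ x ∈ radSeries A X i,
      (f ∘ₗ (radSeries A X l).mkQ) x ∈ socSeries A M k := by
    intro k
    induction k with
    | zero =>
      rintro i rfl x hx
      have : (radSeries A X (i + 0)).mkQ x = 0 := (Submodule.Quotient.mk_eq_zero _).mpr hx
      rw [LinearMap.comp_apply, this, map_zero]
      exact zero_mem _
    | succ k ih =>
      intro i hi
      exact aux_up A _ k i (ih (i + 1) (by omega))
  exact key l 0 (by omega) x trivial

theorem aux_kill {X M : Type} [AddCommGroup X] [Module A X] [AddCommGroup M] [Module A M]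
    (j : ℕ) (f : X →ₗ[A] M) (h : ∀ x, f x ∈ socSeries A M j) :
    ∀ x ∈ radSeries A X j, f x = 0 := by
  have key : ∀ i k, i + k = j → ∀ x ∈ radSeries A X i, f x ∈ socSeries A M k := by
    intro i
    induction i with
    | zero =>
      rintro k hk x -
      have : k = j := by omega
      subst this
      exact h x
    | succ i ih =>
      intro k hk
      exact aux_down A f k i (ih (k + 1) (by omega))
  intro x hx
  exact key j 0 rfl x hx

/-- Let `A` be an Artin algebra with complete set `P_1, …, P_n` of projective
indecomposable modules, `l_i` the Loewy length of `P_i`, and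
`G = ⊕_{i,j} P_i/rad^j(P_i)`, so `R_A = End_A(G)^op` is the ADR algebra and
`P_{k,l} = Hom_A(G, P_k/rad^l(P_k))` are its projective indecomposables. For every
`M` and every `j`, the `R_A`-submodule `Hom_A(G, soc^j M)` of `Hom_A(G, M)` equals the
trace of `⊕_{(k,l) : l ≤ j} P_{k,l}` in `Hom_A(G, M)`, i.e. the sum of the images of
all `R_A`-linear maps (= additive maps commuting with precomposition by endomorphisms
of `G`) from the `P_{k,l}` with `l ≤ j` to `Hom_A(G, M)`. -/
theorem hom_socle_eq_trace [IsArtinianRing A]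
    (n : ℕ) (P : Fin n → Type) [∀ i, AddCommGroup (P i)] [∀ i, Module A (P i)]
    (hproj : ∀ i, Module.Projective A (P i))
    (hfin : ∀ i, Module.Finite A (P i))
    (hnontriv : ∀ i, Nontrivial (P i))
    (hindec : ∀ i (e : (P i) →ₗ[A] (P i)), e.comp e = e → e = 0 ∨ e = LinearMap.id)
    (hdistinct : ∀ i i', i ≠ i' → IsEmpty ((P i) ≃ₗ[A] (P i')))
    (hcomplete : ∀ (Q : Type) [AddCommGroup Q] [Module A Q], Module.Finite A Q →
      Module.Projective A Q → Nontrivial Q →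
      (∀ e : Q →ₗ[A] Q, e.comp e = e → e = 0 ∨ e = LinearMap.id) →
      ∃ i, Nonempty (Q ≃ₗ[A] P i))
    (l : Fin n → ℕ)
    (hl : ∀ i, radSeries A (P i) (l i) = ⊥ ∧ ∀ k < l i, radSeries A (P i) k ≠ ⊥)
    (M : Type) [AddCommGroup M] [Module A M] [Module.Finite A M] (j : ℕ) :
    homInto A (G := Gmod A n P l) (socSeries A M j) =
      ⨆ (k : Fin n) (lv : Fin (l k)) (_ : lv.val + 1 ≤ j)
        (h : (Gmod A n P l →ₗ[A] (P k ⧸ radSeries A (P k) (lv.val + 1))) →+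
              (Gmod A n P l →ₗ[A] M))
        (_ : ∀ (e : Gmod A n P l →ₗ[A] Gmod A n P l) ψ,
              h (ψ.comp e) = (h ψ).comp e),
        h.range := by
  classical
  apply le_antisymm
  · intro φ hφ
    have hdec : φ = ∑ p : (Σ i : Fin n, Fin (l i)),
        (φ ∘ₗ LinearMap.single A _ p) ∘ₗ LinearMap.proj p := by
      refine LinearMap.ext fun x => ?_
      conv_lhs => rw [← Finset.univ_sum_single x]
      simp only [map_sum, LinearMap.sum_apply, LinearMap.comp_apply, LinearMap.proj_apply,
        LinearMap.coe_single]
    rw [hdec]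
    refine AddSubgroup.sum_mem _ ?_
    rintro ⟨k, a⟩ -
    set g := φ ∘ₗ LinearMap.single A
      (fun p : (Σ i : Fin n, Fin (l i)) => P p.1 ⧸ radSeries A (P p.1) (p.2.val + 1)) ⟨k, a⟩
      with hg
    have hgs : ∀ y, g y ∈ socSeries A M j := fun y => hφ _
    rcases Nat.eq_zero_or_pos j with rfl | hj
    · have : g = 0 := LinearMap.ext fun y => by simpa [socSeries] using hgs y
      rw [this, LinearMap.zero_comp]
      exact zero_mem _
    · have hkill := aux_kill A j (g ∘ₗ (radSeries A (P k) (a.val + 1)).mkQ) (fun x => hgs _)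
      let c : Fin (l k) := ⟨min a.val (j - 1), lt_of_le_of_lt (min_le_left _ _) a.2⟩
      have hc1 : c.val + 1 ≤ j := by
        have : c.val ≤ j - 1 := min_le_right _ _
        omega
      have hca : c.val ≤ a.val := min_le_left _ _
      have hc : c.val = a.val ∨ c.val + 1 = j := by
        have : c.val = min a.val (j - 1) := rfl
        omega
      have hle : radSeries A (P k) (c.val + 1) ≤
          LinearMap.ker (g ∘ₗ (radSeries A (P k) (a.val + 1)).mkQ) := by
        intro x hx
        rcases hc with hc | hc
        · rw [hc] at hx
          have : (radSeries A (P k) (a.val + 1)).mkQ x = 0 :=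
            (Submodule.Quotient.mk_eq_zero _).mpr hx
          rw [LinearMap.mem_ker, LinearMap.comp_apply, this, map_zero]
        · rw [hc] at hx
          exact hkill x hx
      let g' := (radSeries A (P k) (c.val + 1)).liftQ _ hle
      let q : (P k ⧸ radSeries A (P k) (a.val + 1)) →ₗ[A] (P k ⧸ radSeries A (P k) (c.val + 1)) :=
        Submodule.factor (aux_rad_anti_s19 A (P k) (by omega))
      have hgq : g = g' ∘ₗ q := by
        refine LinearMap.ext fun y => ?_
        obtain ⟨x, rfl⟩ := Submodule.mkQ_surjective _ y
        rfl
      let H : (Gmod A n P l →ₗ[A] (P k ⧸ radSeries A (P k) (c.val + 1))) →+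
          (Gmod A n P l →ₗ[A] M) :=
        { toFun := fun ψ => g' ∘ₗ ψ
          map_zero' := LinearMap.comp_zero _
          map_add' := fun _ _ => LinearMap.comp_add _ _ _ }
      have hH : ∀ (e : Gmod A n P l →ₗ[A] Gmod A n P l) ψ,
          H (ψ.comp e) = (H ψ).comp e := fun e ψ => rfl
      refine AddSubgroup.mem_iSup_of_mem k (AddSubgroup.mem_iSup_of_mem c
        (AddSubgroup.mem_iSup_of_mem hc1 (AddSubgroup.mem_iSup_of_mem H
          (AddSubgroup.mem_iSup_of_mem hH ?_))))
      refine ⟨q ∘ₗ LinearMap.proj (⟨k, a⟩ : (Σ i : Fin n, Fin (l i))), ?_⟩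
      change g' ∘ₗ (q ∘ₗ _) = _
      rw [hgq]
      rfl
  · refine iSup_le fun k => iSup_le fun c => iSup_le fun hc => iSup_le fun H =>
      iSup_le fun hH => ?_
    rintro _ ⟨ψ, rfl⟩ x
    let p : (Σ i : Fin n, Fin (l i)) := ⟨k, c⟩
    let ι := LinearMap.single A
      (fun p : (Σ i : Fin n, Fin (l i)) => P p.1 ⧸ radSeries A (P p.1) (p.2.val + 1)) p
    let π : Gmod A n P l →ₗ[A] (P k ⧸ radSeries A (P k) (c.val + 1)) := LinearMap.proj p
    have h1 : π.comp (ι.comp ψ) = ψ := by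
      refine LinearMap.ext fun y => ?_
      exact Pi.single_eq_same (M := fun p : (Σ i : Fin n, Fin (l i)) =>
        P p.1 ⧸ radSeries A (P p.1) (p.2.val + 1)) p (ψ y)
    have h2 := hH (ι.comp ψ) π
    rw [h1] at h2
    rw [h2]
    have := hfin k
    exact aux_soc_mono A M hc (aux_into_soc A (c.val + 1) ((H π) ∘ₗ ι) (ψ x))

end
end
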